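/- Let U ⊆ ℝⁿ be open, p ∈ U, and let G = (g₁,…,g_k) : U → ℝ^k be a C¹ map satisfying the strong Łojasiewicz inequality at p. Then G satisfies Milnor's condition (a) at p: there exists an open neighborhood W of p such that for every x ∈ W at which the gradients ∇g₁(x),…,∇g_k(x) are linearly dependent, G(x) = G(p); i.e., near p the critical locus ΣG is contained in G⁻¹(G(p)). -/

import Mathlib

/-- The gradient of the `i`-th component of `G` at `x`. -/
noncomputable def gradComp {n k : ℕ} (G : EuclideanSpace ℝ (Fin n) → EuclideanSpace ℝ (Fin k))
    (i : Fin k) (x : EuclideanSpace ℝ (Fin n)) : EuclideanSpace ℝ (Fin n) :=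
  gradient (fun y => G y i) x

/-- The smallest singular value `σ_k(x)`: the minimum over unit vectors `a ∈ ℝᵏ` of
`‖a₁ ∇g₁(x) + ⋯ + a_k ∇g_k(x)‖`. -/
noncomputable def sigmaSmall {n k : ℕ}
    (G : EuclideanSpace ℝ (Fin n) → EuclideanSpace ℝ (Fin k))
    (x : EuclideanSpace ℝ (Fin n)) : ℝ :=
  sInf ((fun a : EuclideanSpace ℝ (Fin k) => ‖∑ i, a i • gradComp G i x‖) ''
    Metric.sphere (0 : EuclideanSpace ℝ (Fin k)) 1)

/-- The smallest singular value is at most zero where the gradients are linearly dependent. -/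
theorem sigmaSmall_nonpos_of_not_linearIndependent {n k : ℕ}
    {G : EuclideanSpace ℝ (Fin n) → EuclideanSpace ℝ (Fin k)} {x : EuclideanSpace ℝ (Fin n)}
    (h : ¬ LinearIndependent ℝ (fun i => gradComp G i x)) : sigmaSmall G x ≤ 0 := by
  obtain ⟨b, hb, i, hi⟩ := Fintype.not_linearIndependent_iff.1 h
  have hne : WithLp.toLp 2 b ≠ (0 : EuclideanSpace ℝ (Fin k)) := fun h0 =>
    hi (by simpa using congrArg (fun v : EuclideanSpace ℝ (Fin k) => v i) h0)
  refine csInf_le ⟨0, ?_⟩ ⟨‖WithLp.toLp 2 b‖⁻¹ • WithLp.toLp 2 b, ?_, ?_⟩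
  · rintro _ ⟨a, -, rfl⟩
    exact norm_nonneg _
  · rw [mem_sphere_zero_iff_norm, norm_smul, norm_inv, norm_norm,
      inv_mul_cancel₀ (norm_ne_zero_iff.2 hne)]
  · simp [mul_smul, ← Finset.smul_sum, hb]

/-- An Ł-map satisfies Milnor's condition (a): near `p`, every point where the gradients of
the components of `G` are linearly dependent is mapped to `G(p)`. -/
theorem milnor_condition_a_of_lmap {n k : ℕ} {U : Set (EuclideanSpace ℝ (Fin n))}
    (hU : IsOpen U) {p : EuclideanSpace ℝ (Fin n)} (hp : p ∈ U)
    {G : EuclideanSpace ℝ (Fin n) → EuclideanSpace ℝ (Fin k)} (hG : ContDiffOn ℝ 1 G U)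
    (hloj : ∃ W : Set (EuclideanSpace ℝ (Fin n)), IsOpen W ∧ p ∈ W ∧ W ⊆ U ∧
      ∃ c θ : ℝ, 0 < c ∧ 0 < θ ∧ θ < 1 ∧ ∀ x ∈ W,
        ‖G x - G p‖ ^ θ ≤ c * sigmaSmall G x) :
    ∃ W' : Set (EuclideanSpace ℝ (Fin n)), IsOpen W' ∧ p ∈ W' ∧ W' ⊆ U ∧
      ∀ x ∈ W', ¬ LinearIndependent ℝ (fun i => gradComp G i x) → G x = G p := by
  obtain ⟨W, hW, hpW, hWU, c, θ, hc, hθ, -, hle⟩ := hloj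
  refine ⟨W, hW, hpW, hWU, fun x hx hdep => ?_⟩
  have hpow : ‖G x - G p‖ ^ θ ≤ 0 := (hle x hx).trans
    (mul_nonpos_of_nonneg_of_nonpos hc.le (sigmaSmall_nonpos_of_not_linearIndependent hdep))
  have hzero := (Real.rpow_eq_zero (norm_nonneg _) hθ.ne').1
    (hpow.antisymm (Real.rpow_nonneg (norm_nonneg _) θ))
  exact sub_eq_zero.1 (norm_eq_zero.1 hzero)
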